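/- Let W = {1, (φ + φ⁻¹j + k)/2, (φ − φ⁻¹j + k)/2, (φ + i + φ⁻¹k)/2} ⊂ V, a set of four pairwise adjacent facet centers of the 120-cell (the four facets meeting at a common vertex). The subgroup of the symmetry group A of the 120-cell that maps W onto itself has exactly 24 elements, and restriction to W gives a group isomorphism from this stabilizer onto the full symmetric group on the four elements of W. In other words, the stabilizer of every vertex in the symmetry group of the 120-cell is the symmetric group S₄. -/

import Mathlib

open Quaternion

noncomputable section

/-- The golden ratio. -/
def gold : ℝ := (1 + Real.sqrt 5) / 2

/-- The coordinates of a quaternion, viewed as a vector in `ℝ⁴`. -/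
def qcoords (q : ℍ[ℝ]) : Fin 4 → ℝ := ![q.re, q.imI, q.imJ, q.imK]

/-- The standard inner product of two quaternions viewed as vectors in `ℝ⁴`. -/
def qinner (p q : ℍ[ℝ]) : ℝ := ∑ i, qcoords p i * qcoords q i

/-- A choice of signs. -/
def IsSign (s : Fin 4 → ℝ) : Prop := ∀ i, s i = 1 ∨ s i = -1

/-- The coordinate multiset `(0, 1, φ⁻¹, φ)`. -/
def baseVec : Fin 4 → ℝ := ![0, 1, gold⁻¹, gold]

/-- The 120 facet centers of the right-angled 120-cell: the 24 Hurwitz units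
`±1, ±i, ±j, ±k, (±1±i±j±k)/2` together with the 96 quaternions obtained from
`(0 ± i ± φ⁻¹j ± φk)/2` by even permutations of the coordinates `(0,1,φ⁻¹,φ)`
and all choices of signs. -/
def Vcell : Set ℍ[ℝ] :=
  {q | (∃ s : Fin 4 → ℝ, IsSign s ∧
          ((∃ i : Fin 4, ∀ j, qcoords q j = if j = i then s i else 0) ∨
           (∀ j, qcoords q j = s j / 2))) ∨
       (∃ σ : Equiv.Perm (Fin 4), σ ∈ alternatingGroup (Fin 4) ∧
          ∃ s : Fin 4 → ℝ, IsSign s ∧ ∀ j, qcoords q j = s j * baseVec (σ j) / 2)}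

/-- Facet adjacency in the 120-cell: two facet centers are adjacent iff their
inner product equals `φ/2 = cos (π/5)`. -/
def Adj (p q : ℍ[ℝ]) : Prop := p ∈ Vcell ∧ q ∈ Vcell ∧ qinner p q = gold / 2

/-- A nonsingular coloring (characteristic function) of the 120-cell: facets get
nonzero colors in `(ℤ/2)⁴` and any four pairwise adjacent facets get a basis. -/
def Nonsingular (lam : ℍ[ℝ] → (Fin 4 → ZMod 2)) : Prop :=
  (∀ q ∈ Vcell, lam q ≠ 0) ∧
  ∀ a b c d : ℍ[ℝ], Adj a b → Adj a c → Adj a d → Adj b c → Adj b d → Adj c d →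
    LinearIndependent (ZMod 2) ![lam a, lam b, lam c, lam d]

/-- The symmetry group of the 120-cell, realized as the permutations of `Vcell`
of the form `x ↦ pxq` or `x ↦ p x̄ q` with `p, q ∈ Vcell`. -/
def SymE : Set (ℍ[ℝ] → ℍ[ℝ]) :=
  {f | ∃ p ∈ Vcell, ∃ q ∈ Vcell,
        (f = fun x => p * x * q) ∨ (f = fun x => p * star x * q)}

/-- DJ-equivalence of colorings: `λ = g ∘ μ ∘ a` on the facets, for some
`g ∈ GL₄(ℤ/2)` and some symmetry `a` of the 120-cell. -/
def DJEquiv (lam mu : ℍ[ℝ] → (Fin 4 → ZMod 2)) : Prop :=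
  ∃ g : (Fin 4 → ZMod 2) ≃ₗ[ZMod 2] (Fin 4 → ZMod 2),
    ∃ a ∈ SymE, ∀ x ∈ Vcell, lam x = g (mu (a x))

/-- Orientability (Nakayama–Nishimura): after a change of basis every color has
odd weight. -/
def OrientableColoring (lam : ℍ[ℝ] → (Fin 4 → ZMod 2)) : Prop :=
  ∃ g : (Fin 4 → ZMod 2) ≃ₗ[ZMod 2] (Fin 4 → ZMod 2),
    ∀ x ∈ Vcell, ∑ i, g (lam x) i = 1


/-- The four facet centers of the 120-cell meeting at a common vertex:
`1, (φ + φ⁻¹j + k)/2, (φ − φ⁻¹j + k)/2, (φ + i + φ⁻¹k)/2`. -/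
def W12 : Set ℍ[ℝ] :=
  {1, ⟨gold / 2, 0, gold⁻¹ / 2, 1 / 2⟩, ⟨gold / 2, 0, -(gold⁻¹) / 2, 1 / 2⟩,
    ⟨gold / 2, 1 / 2, 0, gold⁻¹ / 2⟩}

/-! ### An exact integral model

An element `(a, b)` of `ℤ × ℤ` stands for `a + b φ`, and a vector of four such
pairs stands for twice a quaternion. -/

/-- Product in `ℤ[φ]`. -/
def zm (x y : ℤ × ℤ) : ℤ × ℤ := (x.1 * y.1 + x.2 * y.2, x.1 * y.2 + x.2 * y.1 + x.2 * y.2)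

/-- Quaternion product in the model (not rescaled). -/
def mm (a b : Fin 4 → ℤ × ℤ) : Fin 4 → ℤ × ℤ :=
  ![zm (a 0) (b 0) - zm (a 1) (b 1) - zm (a 2) (b 2) - zm (a 3) (b 3),
    zm (a 0) (b 1) + zm (a 1) (b 0) + zm (a 2) (b 3) - zm (a 3) (b 2),
    zm (a 0) (b 2) - zm (a 1) (b 3) + zm (a 2) (b 0) + zm (a 3) (b 1),
    zm (a 0) (b 3) + zm (a 1) (b 2) - zm (a 2) (b 1) + zm (a 3) (b 0)]

/-- Conjugation in the model. -/
def ms (a : Fin 4 → ℤ × ℤ) : Fin 4 → ℤ × ℤ := ![a 0, -a 1, -a 2, -a 3]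

/-- Exact halving in the model. -/
def mhalf (a : Fin 4 → ℤ × ℤ) : Fin 4 → ℤ × ℤ := fun i => ((a i).1 / 2, (a i).2 / 2)

/-- Multiplication by four in the model. -/
def mfour (a : Fin 4 → ℤ × ℤ) : Fin 4 → ℤ × ℤ := fun i => (4 * (a i).1, 4 * (a i).2)

/-- The model of `baseVec`. -/
def mbase : Fin 4 → ℤ × ℤ := ![(0, 0), (1, 0), (-1, 1), (0, 1)]

/-- Membership in the facet set, in the model. -/
def IsV (x : Fin 4 → ℤ × ℤ) : Prop :=
  (∃ i, ∀ j, if j = i then (x j = (2, 0) ∨ x j = (-2, 0)) else x j = (0, 0)) ∨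
  (∀ j, x j = (1, 0) ∨ x j = (-1, 0)) ∨
  (∃ σ : Equiv.Perm (Fin 4), (∀ j, x j = mbase (σ j) ∨ x j = -mbase (σ j)) ∧
    Equiv.Perm.sign σ = 1)

instance (x : Fin 4 → ℤ × ℤ) : Decidable (IsV x) := by unfold IsV; infer_instance

/-- The four facets in the model. -/
def mw : Fin 4 → Fin 4 → ℤ × ℤ :=
  ![![(2, 0), (0, 0), (0, 0), (0, 0)], ![(0, 1), (0, 0), (-1, 1), (1, 0)],
    ![(0, 1), (0, 0), (1, -1), (1, 0)], ![(0, 1), (1, 0), (0, 0), (-1, 1)]]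

/-- Left factors of the 24 symmetries. -/
def plist : List (Fin 4 → ℤ × ℤ) := [
  ![(0, 0), (-1, 0), (1, -1), (0, 1)],
  ![(-1, 0), (-1, 0), (1, 0), (-1, 0)],
  ![(0, -1), (-1, 1), (1, 0), (0, 0)],
  ![(1, -1), (0, 0), (1, 0), (0, 1)],
  ![(-1, 0), (0, 0), (0, -1), (-1, 1)],
  ![(-1, 0), (-1, 1), (0, 0), (0, -1)],
  ![(0, 0), (1, -1), (0, -1), (-1, 0)],
  ![(1, 0), (1, 0), (1, 0), (1, 0)],
  ![(-1, 0), (0, 0), (0, 1), (1, -1)],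
  ![(-1, 0), (0, -1), (1, -1), (0, 0)],
  ![(-2, 0), (0, 0), (0, 0), (0, 0)],
  ![(-1, 0), (-1, 0), (1, 0), (1, 0)],
  ![(0, -1), (-1, 1), (-1, 0), (0, 0)],
  ![(0, 0), (0, 1), (-1, 0), (1, -1)],
  ![(1, 0), (-1, 1), (0, 0), (0, 1)],
  ![(0, 0), (0, 0), (-2, 0), (0, 0)],
  ![(-1, 1), (0, -1), (0, 0), (-1, 0)],
  ![(1, 0), (0, -1), (1, -1), (0, 0)],
  ![(0, 0), (0, 1), (1, 0), (1, -1)],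
  ![(-1, 0), (1, 0), (-1, 0), (-1, 0)],
  ![(0, 0), (0, -1), (1, 0), (1, -1)],
  ![(-1, 1), (0, 0), (1, 0), (0, -1)],
  ![(-1, 0), (-1, 1), (0, 0), (0, 1)],
  ![(0, -1), (-1, 0), (0, 0), (-1, 1)]]

/-- Optional conjugation. -/
def mcs (b : Bool) (x : Fin 4 → ℤ × ℤ) : Fin 4 → ℤ × ℤ := if b then ms x else x

theorem model_exists : ∀ a b c d : Fin 4, [a, b, c, d].Nodup →
    ∃ p ∈ plist, ∃ e : Bool,
      (mm (mm p (mcs e (mw 0))) (mhalf (mm (ms p) (mw a))) = mfour (mw a) ∧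
       mm (mm p (mcs e (mw 1))) (mhalf (mm (ms p) (mw a))) = mfour (mw b) ∧
       mm (mm p (mcs e (mw 2))) (mhalf (mm (ms p) (mw a))) = mfour (mw c) ∧
       mm (mm p (mcs e (mw 3))) (mhalf (mm (ms p) (mw a))) = mfour (mw d)) ∧
      IsV p ∧ IsV (mhalf (mm (ms p) (mw a))) := by
  decide +kernel

theorem model_W : ∀ i, IsV (mw i) := by decide +kernel

/-! ### Back to real quaternions -/

theorem gold_sq : gold ^ 2 = gold + 1 := by
  have h : Real.sqrt 5 ^ 2 = 5 := Real.sq_sqrt (by norm_num)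
  unfold gold
  linear_combination h / 4

theorem gold_pos : 0 < gold := by unfold gold; positivity

theorem gold_inv : gold⁻¹ = gold - 1 := by
  have := gold_pos
  field_simp
  linear_combination -gold_sq

/-- Value of an element of `ℤ[φ]`. -/
def zv (x : ℤ × ℤ) : ℝ := x.1 + x.2 * gold

theorem zv_add (x y : ℤ × ℤ) : zv (x + y) = zv x + zv y := by
  simp [zv]; ring

theorem zv_neg (x : ℤ × ℤ) : zv (-x) = -zv x := by
  simp [zv]; ring

theorem zv_sub (x y : ℤ × ℤ) : zv (x - y) = zv x - zv y := by
  simp [zv]; ring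

theorem zv_mul (x y : ℤ × ℤ) : zv (zm x y) = zv x * zv y := by
  simp only [zv, zm]
  push_cast
  linear_combination (-(x.2 : ℝ) * y.2) * gold_sq

/-- The quaternion represented by a model vector. -/
def emb (x : Fin 4 → ℤ × ℤ) : ℍ[ℝ] := ⟨zv (x 0) / 2, zv (x 1) / 2, zv (x 2) / 2, zv (x 3) / 2⟩

theorem emb_re (x : Fin 4 → ℤ × ℤ) : (emb x).re = zv (x 0) / 2 := rfl
theorem emb_imI (x : Fin 4 → ℤ × ℤ) : (emb x).imI = zv (x 1) / 2 := rfl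
theorem emb_imJ (x : Fin 4 → ℤ × ℤ) : (emb x).imJ = zv (x 2) / 2 := rfl
theorem emb_imK (x : Fin 4 → ℤ × ℤ) : (emb x).imK = zv (x 3) / 2 := rfl

theorem emb_mul (x y : Fin 4 → ℤ × ℤ) : emb (mm x y) = (2 : ℝ) • (emb x * emb y) := by
  ext <;> simp [emb_re, emb_imI, emb_imJ, emb_imK, mm, zv_add, zv_sub, zv_mul] <;> ring

theorem emb_star (x : Fin 4 → ℤ × ℤ) : emb (ms x) = star (emb x) := by
  ext <;> simp [emb_re, emb_imI, emb_imJ, emb_imK, ms, zv_neg, neg_div]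

theorem emb_four (x : Fin 4 → ℤ × ℤ) : emb (mfour x) = (4 : ℝ) • emb x := by
  ext <;> simp [emb_re, emb_imI, emb_imJ, emb_imK, mfour, zv] <;> ring

theorem emb_triple {p x q y : Fin 4 → ℤ × ℤ} (h : mm (mm p x) q = mfour y) :
    emb p * emb x * emb q = emb y := by
  have h1 : emb (mm (mm p x) q) = emb (mfour y) := by rw [h]
  rw [emb_mul, emb_mul, emb_four, smul_mul_assoc, smul_smul] at h1
  have h2 : (4 : ℝ) • (emb p * emb x * emb q) = (4 : ℝ) • emb y := by
    rw [← h1]; norm_num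
  exact smul_right_injective _ (by norm_num : (4 : ℝ) ≠ 0) h2

theorem qcoords_emb (x : Fin 4 → ℤ × ℤ) (j : Fin 4) : qcoords (emb x) j = zv (x j) / 2 := by
  fin_cases j <;> rfl

theorem zv_mbase (j : Fin 4) : zv (mbase j) = baseVec j := by
  fin_cases j <;> simp [zv, mbase, baseVec, gold_inv]
  ring

theorem emb_mem {x : Fin 4 → ℤ × ℤ} (h : IsV x) : emb x ∈ Vcell := by
  rcases h with ⟨i, h⟩ | h | ⟨σ, h, hs⟩
  · left
    refine ⟨fun _ => zv (x i) / 2, fun _ => ?_, Or.inl ⟨i, fun j => ?_⟩⟩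
    · have := h i
      rw [if_pos rfl] at this
      rcases this with h | h <;> simp [h, zv]
    · rw [qcoords_emb]
      have := h j
      split_ifs at this ⊢ with hji
      · rw [hji]
      · simp [this, zv]
  · left
    refine ⟨fun j => zv (x j), fun j => ?_, Or.inr fun j => qcoords_emb x j⟩
    rcases h j with h | h <;> simp [h, zv]
  · right
    refine ⟨σ, Equiv.Perm.mem_alternatingGroup.2 hs, ?_⟩
    have : ∀ j, ∃ s : ℝ, (s = 1 ∨ s = -1) ∧ zv (x j) = s * baseVec (σ j) := by
      intro j
      rcases h j with h | h
      · exact ⟨1, Or.inl rfl, by rw [h, zv_mbase, one_mul]⟩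
      · exact ⟨-1, Or.inr rfl, by rw [h, zv_neg, zv_mbase]; ring⟩
    choose s hs1 hs2 using this
    exact ⟨s, hs1, fun j => by rw [qcoords_emb, hs2]⟩

/-- The four facets as an indexed family. -/
def w (i : Fin 4) : ℍ[ℝ] := emb (mw i)

theorem w0 : w 0 = 1 := by ext <;> simp [w, emb, mw, zv]
theorem w1 : w 1 = ⟨gold / 2, 0, gold⁻¹ / 2, 1 / 2⟩ := by
  ext <;> simp [w, emb, mw, zv, gold_inv]
  ring
theorem w2 : w 2 = ⟨gold / 2, 0, -(gold⁻¹) / 2, 1 / 2⟩ := by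
  ext <;> simp [w, emb, mw, zv, gold_inv]
  ring
theorem w3 : w 3 = ⟨gold / 2, 1 / 2, 0, gold⁻¹ / 2⟩ := by
  ext <;> simp [w, emb, mw, zv, gold_inv]
  ring

theorem W12_eq : W12 = Set.range w := by
  ext x
  simp only [W12, Set.mem_insert_iff, Set.mem_singleton_iff, Set.mem_range, Fin.exists_fin_succ,
    ← w0, ← w1, ← w2, ← w3]
  simp [eq_comm]

theorem qinner_w (i j : Fin 4) (h : i ≠ j) : qinner (w i) (w j) = gold / 2 := by
  have := gold_sq
  fin_cases i <;> fin_cases j <;> first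
    | exact absurd rfl h
    | (simp [qinner, Fin.sum_univ_four, w, qcoords_emb, mw, zv]
       try linarith)

theorem qinner_w_self (i : Fin 4) : qinner (w i) (w i) = 1 := by
  have := gold_sq
  fin_cases i <;>
    (simp [qinner, Fin.sum_univ_four, w, qcoords_emb, mw, zv]
     try linarith)

theorem w_inj : Function.Injective w := by
  intro i j h
  by_contra hij
  have h1 := qinner_w i j hij
  rw [← h, qinner_w_self] at h1
  have := gold_sq
  have h2 : gold = 2 := by linarith
  rw [h2] at this
  norm_num at this

theorem exists_sym (π : Equiv.Perm (Fin 4)) : ∃ f ∈ SymE, ∀ i, f (w i) = w (π i) := by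
  have hnd : [π 0, π 1, π 2, π 3].Nodup := by simp
  obtain ⟨p, -, e, ⟨h0, h1, h2, h3⟩, hp, hq⟩ := model_exists _ _ _ _ hnd
  have key : ∀ i, emb p * emb (mcs e (mw i)) * emb (mhalf (mm (ms p) (mw (π 0)))) =
      w (π i) := by
    intro i
    fin_cases i
    exacts [emb_triple h0, emb_triple h1, emb_triple h2, emb_triple h3]
  cases e
  · exact ⟨_, ⟨_, emb_mem hp, _, emb_mem hq, Or.inl rfl⟩, key⟩
  · refine ⟨_, ⟨_, emb_mem hp, _, emb_mem hq, Or.inr rfl⟩, fun i => ?_⟩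
    have := key i
    simp only [mcs, if_true, emb_star] at this
    exact this

theorem sym_linear {f : ℍ[ℝ] → ℍ[ℝ]} (hf : f ∈ SymE) :
    (∀ x y, f (x + y) = f x + f y) ∧ ∀ (c : ℝ) x, f (c • x) = c • f x := by
  obtain ⟨p, -, q, -, rfl | rfl⟩ := hf
  · exact ⟨fun x y => by simp only [mul_add, add_mul], fun c x => by simp⟩
  · exact ⟨fun x y => by simp only [star_add, mul_add, add_mul], fun c x => by simp⟩

theorem w_span (x : ℍ[ℝ]) : ∃ a b c d : ℝ, x = a • w 0 + b • w 1 + c • w 2 + d • w 3 := by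
  have := gold_sq
  -- first use `w 3` for the `i` coordinate, then `w 1`, `w 2`, then `w 0`
  refine ⟨x.re - gold * (x.imI + (x.imK - (gold - 1) * x.imI)),
    (x.imK - (gold - 1) * x.imI) + gold * x.imJ,
    (x.imK - (gold - 1) * x.imI) - gold * x.imJ, 2 * x.imI, ?_⟩
  ext <;> simp [w, emb_re, emb_imI, emb_imJ, emb_imK, mw, zv] <;> grind

theorem sym_ext {f g : ℍ[ℝ] → ℍ[ℝ]} (hf : f ∈ SymE) (hg : g ∈ SymE)
    (h : ∀ i, f (w i) = g (w i)) : f = g := by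
  funext x
  obtain ⟨a, b, c, d, rfl⟩ := w_span x
  simp only [(sym_linear hf).1, (sym_linear hf).2, (sym_linear hg).1, (sym_linear hg).2, h]

theorem finite_W12 : W12.Finite := by rw [W12_eq]; exact Set.finite_range w

/-- The facets of `W12` are indexed by `Fin 4`. -/
def eW : Fin 4 ≃ ↥W12 := (Equiv.ofInjective w w_inj).trans (Equiv.setCongr W12_eq.symm)

theorem eW_coe (i : Fin 4) : (eW i : ℍ[ℝ]) = w i := rfl

theorem exists_unique_sym (π : Equiv.Perm ↥W12) :
    ∃! f : {f : ℍ[ℝ] → ℍ[ℝ] // f ∈ SymE ∧ f '' W12 = W12},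
        ∀ w : ↥W12, f.1 ↑w = ↑(π w) := by
  obtain ⟨f, hf, h⟩ := exists_sym ((eW.trans π).trans eW.symm)
  have h' : ∀ v : ↥W12, f ↑v = ↑(π v) := by
    intro v
    obtain ⟨i, rfl⟩ := eW.surjective v
    rw [eW_coe, h, ← eW_coe]
    simp
  have himg : f '' W12 = W12 := by
    ext x
    constructor
    · rintro ⟨v, hv, rfl⟩
      rw [h' ⟨v, hv⟩]
      exact Subtype.coe_prop _
    · intro hx
      refine ⟨π.symm ⟨x, hx⟩, Subtype.coe_prop _, ?_⟩
      rw [h']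
      simp
  refine ⟨⟨f, hf, himg⟩, h', ?_⟩
  rintro ⟨g, hg, hgi⟩ hgw
  apply Subtype.ext
  refine sym_ext hg hf fun i => ?_
  rw [← eW_coe]
  exact (hgw _).trans (h' _).symm

theorem card_stab : Set.ncard {f ∈ SymE | f '' W12 = W12} = 24 := by
  choose F hF hU using exists_unique_sym
  have hbij : Function.Bijective F := by
    constructor
    · intro π ρ h
      refine Equiv.ext fun v => Subtype.ext ?_
      rw [← hF π v, h, hF ρ v]
    · rintro ⟨g, hg, hgi⟩
      have hm : ∀ v : ↥W12, g v ∈ W12 := fun v => by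
        have : g v ∈ g '' W12 := ⟨v, v.2, rfl⟩
        rwa [hgi] at this
      let r : ↥W12 → ↥W12 := fun v => ⟨g v, hm v⟩
      have hs : Function.Surjective r := by
        rintro ⟨y, hy⟩
        have hy' := hy
        rw [← hgi] at hy'
        obtain ⟨v, hv, rfl⟩ := hy'
        exact ⟨⟨v, hv⟩, rfl⟩
      have : Finite ↥W12 := finite_W12
      refine ⟨Equiv.ofBijective r (Finite.surjective_iff_bijective.1 hs), ?_⟩
      exact (hU _ ⟨g, hg, hgi⟩ fun v => rfl).symm
  have h1 := Nat.card_congr (Equiv.ofBijective F hbij)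
  have h2 := Nat.card_congr (Equiv.permCongr eW)
  rw [← Nat.card_coe_set_eq]
  change Nat.card {f : ℍ[ℝ] → ℍ[ℝ] // f ∈ SymE ∧ f '' W12 = W12} = 24
  rw [← h1, ← h2, Nat.card_perm, Nat.card_fin]
  rfl

/-- The stabilizer of a vertex of the 120-cell in its symmetry group is the
symmetric group `S₄`: `W12` consists of four pairwise adjacent facet centers,
the symmetries preserving `W12` number exactly 24, and restriction to `W12`
is a bijection onto the full symmetric group on `W12`. -/
theorem vertex_stabilizer_S4 :
    W12 ⊆ Vcell ∧
    (∀ p ∈ W12, ∀ q ∈ W12, p ≠ q → qinner p q = gold / 2) ∧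
    Set.ncard {f ∈ SymE | f '' W12 = W12} = 24 ∧
    (∀ π : Equiv.Perm ↥W12,
      ∃! f : {f : ℍ[ℝ] → ℍ[ℝ] // f ∈ SymE ∧ f '' W12 = W12},
        ∀ w : ↥W12, f.1 ↑w = ↑(π w)) := by
  refine ⟨?_, ?_, card_stab, exists_unique_sym⟩
  · rw [W12_eq]
    rintro _ ⟨i, rfl⟩
    exact emb_mem (model_W i)
  · rw [W12_eq]
    rintro _ ⟨i, rfl⟩ _ ⟨j, rfl⟩ h
    exact qinner_w i j fun hij => h (by rw [hij])
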